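/- arXiv:2211.04541 — 2 statements merged into one kernel-verified Lean document; each statement's English description precedes it below -/
import Mathlib

section
/- Let 0 < a < b be real numbers. Then there exist a set I with card(I) = 𝔠 and a linearly independent family (F^k)_{k∈I} of dense vector subspaces of ℓ^b such that the vector subspace of ℓ^b spanned by ⋃_{k∈I} F^k is contained in (ℓ^b \ ℓ^a) ∪ {0}. -/
open Filter Topology

noncomputable section

/-- The topology generated by the open balls of a distance function `d`.
When `d` is an actual metric this is precisely the metric topology. -/
def topOfDist {α : Type*} (d : α → α → ℝ) : TopologicalSpace α :=
  TopologicalSpace.generateFrom {S | ∃ x r, S = {y | d x y < r}}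

/-- The space `ℓ^p`, `0 < p < ∞`, of complex sequences. -/
def lpSet (p : ℝ) : Set (ℕ → ℂ) := {x | Summable fun n => ‖x n‖ ^ p}

/-- The metric `d^p` of `ℓ^p`: the norm metric for `p ≥ 1`, and
`d^p(x,y) = Σ |x n - y n| ^ p` for `0 < p < 1`. -/
def dlp (p : ℝ) (x y : ℕ → ℂ) : ℝ :=
  if 1 ≤ p then (∑' n, ‖x n - y n‖ ^ p) ^ (1 / p) else ∑' n, ‖x n - y n‖ ^ p

/-- The topology of `ℓ^p` induced by the metric `d^p`. -/
def lpTopology (p : ℝ) : TopologicalSpace ↥(lpSet p) :=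
  topOfDist fun x y => dlp p x.1 y.1

lemma lpSet_iff_memℓp {p : ℝ} (hp : 0 < p) (x : ℕ → ℂ) :
    x ∈ lpSet p ↔ Memℓp x (ENNReal.ofReal p) := by
  have h : (ENNReal.ofReal p).toReal = p := ENNReal.toReal_ofReal hp.le
  rw [memℓp_gen_iff (by rwa [h]), h]
  rfl

/-- `ℓ^p` as a submodule of the space of all sequences. -/
def lpSeqSubmodule (p : ℝ) (hp : 0 < p) : Submodule ℂ (ℕ → ℂ) where
  carrier := lpSet p
  zero_mem' := (lpSet_iff_memℓp hp _).2 zero_memℓp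
  add_mem' hx hy :=
    (lpSet_iff_memℓp hp _).2 (((lpSet_iff_memℓp hp _).1 hx).add ((lpSet_iff_memℓp hp _).1 hy))
  smul_mem' c _ hx := (lpSet_iff_memℓp hp _).2 (((lpSet_iff_memℓp hp _).1 hx).const_smul c)

lemma finsupp_mem_lpSet {p : ℝ} (hp : 0 < p) (q : ℕ →₀ ℂ) : (q : ℕ → ℂ) ∈ lpSet p := by
  refine summable_of_ne_finset_zero (s := q.support) fun n hn => ?_
  rw [Finsupp.notMem_support_iff.1 hn, norm_zero, Real.zero_rpow hp.ne']

lemma dlp_triangle {p : ℝ} (hp : 0 < p) {x y z : ℕ → ℂ} (hx : x ∈ lpSet p) (hy : y ∈ lpSet p)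
    (hz : z ∈ lpSet p) : dlp p x z ≤ dlp p x y + dlp p y z := by
  have hxy : Summable fun n => ‖x n - y n‖ ^ p := (lpSeqSubmodule p hp).sub_mem hx hy
  have hyz : Summable fun n => ‖y n - z n‖ ^ p := (lpSeqSubmodule p hp).sub_mem hy hz
  have hxz : Summable fun n => ‖x n - z n‖ ^ p := (lpSeqSubmodule p hp).sub_mem hx hz
  have key (n : ℕ) : ‖x n - z n‖ ^ p ≤ (‖x n - y n‖ + ‖y n - z n‖) ^ p :=
    Real.rpow_le_rpow (norm_nonneg _) (norm_sub_le_norm_sub_add_norm_sub _ _ _) hp.le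
  unfold dlp
  split_ifs with h1
  · obtain ⟨hs, hle⟩ := Real.Lp_add_le_tsum_of_nonneg h1 (fun n => norm_nonneg (x n - y n))
      (fun n => norm_nonneg (y n - z n)) hxy hyz
    refine le_trans (Real.rpow_le_rpow (tsum_nonneg fun n => by positivity)
      (hxz.tsum_le_tsum key hs) (by positivity)) hle
  · rw [← hxy.tsum_add hyz]
    exact hxz.tsum_le_tsum (fun n => (key n).trans (Real.rpow_add_le_add_rpow (norm_nonneg _)
      (norm_nonneg _) hp.le (not_le.1 h1).le)) (hxy.add hyz)

/-- In a topology generated by the balls of a distance satisfying the triangle inequality, every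
neighbourhood of a point contains a ball centred at it. -/
lemma exists_ball_subset_of_isOpen {α : Type*} {d : α → α → ℝ}
    (tri : ∀ x y z, d x z ≤ d x y + d y z) {U : Set α} (hU : IsOpen[topOfDist d] U)
    {x : α} (hx : x ∈ U) : ∃ r > 0, ∀ y, d x y < r → y ∈ U := by
  induction hU with
  | basic S hS =>
    obtain ⟨z, r, rfl⟩ := hS
    refine ⟨r - d z x, sub_pos.2 hx, fun y hy => ?_⟩
    have := tri z x y
    change d z y < r
    linarith
  | univ => exact ⟨1, one_pos, fun _ _ => trivial⟩
  | inter S T _ _ ihS ihT =>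
    obtain ⟨r, hr, h⟩ := ihS hx.1
    obtain ⟨t, ht, h'⟩ := ihT hx.2
    exact ⟨min r t, lt_min hr ht, fun y hy =>
      ⟨h y (hy.trans_le (min_le_left _ _)), h' y (hy.trans_le (min_le_right _ _))⟩⟩
  | sUnion S _ ih =>
    obtain ⟨T, hT, hxT⟩ := hx
    obtain ⟨r, hr, h⟩ := ih T hT hxT
    exact ⟨r, hr, fun y hy => ⟨T, hT, h y hy⟩⟩

lemma dense_lpTopology_of_tendsto {p : ℝ} (hp : 0 < p) {S : Set (ℕ → ℂ)} (hS : S ⊆ lpSet p)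
    (h : ∀ x ∈ lpSet p, ∃ y : ℕ → ℕ → ℂ, (∀ N, y N ∈ S) ∧
      Tendsto (fun N => ∑' n, ‖x n - y N n‖ ^ p) atTop (𝓝 0)) :
    @Dense ↥(lpSet p) (lpTopology p) (Subtype.val ⁻¹' S) := by
  let := lpTopology p
  refine dense_iff_inter_open.2 fun U hU ⟨x, hxU⟩ => ?_
  obtain ⟨r, hr, hball⟩ := exists_ball_subset_of_isOpen
    (d := fun x y : ↥(lpSet p) => dlp p x.1 y.1) (fun x y z => dlp_triangle hp x.2 y.2 z.2) hU hxU
  obtain ⟨y, hyS, hy⟩ := h x.1 x.2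
  have hlim : Tendsto (fun N => dlp p x.1 (y N)) atTop (𝓝 0) := by
    unfold dlp
    split_ifs
    · have := hy.rpow_const (p := 1 / p) (Or.inr (by positivity))
      rwa [Real.zero_rpow (by positivity)] at this
    · exact hy
  obtain ⟨N, hN⟩ := (hlim.eventually_lt_const hr).exists
  exact ⟨⟨y N, hS (hyS N)⟩, hball _ hN, hyS N⟩

/-- The sequence `(n + 1) ^ (-s)`. -/
def powerSeq (s : ℝ) (n : ℕ) : ℂ := (((n : ℝ) + 1) ^ (-s) : ℝ)

lemma norm_powerSeq (s : ℝ) (n : ℕ) : ‖powerSeq s n‖ = ((n : ℝ) + 1) ^ (-s) := by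
  rw [powerSeq, Complex.norm_real, Real.norm_of_nonneg (by positivity)]

lemma summable_nat_add_one_rpow {t : ℝ} :
    (Summable fun n : ℕ => ((n : ℝ) + 1) ^ t) ↔ t < -1 := by
  rw [← Real.summable_nat_rpow, ← summable_nat_add_iff 1 (f := fun n : ℕ => (n : ℝ) ^ t)]
  simp

lemma powerSeq_mem_lpSet_iff {p s : ℝ} : powerSeq s ∈ lpSet p ↔ 1 < s * p := by
  have (n : ℕ) : ‖powerSeq s n‖ ^ p = ((n : ℝ) + 1) ^ (-s * p) := by
    rw [norm_powerSeq, ← Real.rpow_mul (by positivity)]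
  simp only [lpSet, Set.mem_ofPred_eq, this, summable_nat_add_one_rpow, neg_mul, neg_lt_neg_iff]

lemma tendsto_rpow_mul_powerSeq {s t : ℝ} (hst : s < t) :
    Tendsto (fun n : ℕ => (((n : ℝ) + 1) ^ s : ℝ) * powerSeq t n) atTop (𝓝 0) := by
  have h : Tendsto (fun n : ℕ => ((n : ℝ) + 1) ^ (-(t - s))) atTop (𝓝 0) :=
    (tendsto_rpow_neg_atTop (sub_pos.2 hst)).comp
      (tendsto_natCast_atTop_atTop.atTop_add tendsto_const_nhds)
  refine ((Complex.continuous_ofReal.tendsto 0).comp h).congr fun n => ?_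
  simp only [Function.comp, powerSeq]
  rw [← Complex.ofReal_mul, ← Real.rpow_add (by positivity)]
  ring_nf

lemma rpow_mul_powerSeq_self (s : ℝ) (n : ℕ) :
    (((n : ℝ) + 1) ^ s : ℝ) * powerSeq s n = 1 := by
  rw [powerSeq, ← Complex.ofReal_mul, ← Real.rpow_add (by positivity)]
  simp

/-- If `(n + 1) ^ s * x n` has a nonzero limit and `s p ≤ 1`, then `x` is not in `ℓ^p`. -/
lemma notMem_lpSet_of_tendsto {p s : ℝ} (hp : 0 < p) (hsp : s * p ≤ 1) {x : ℕ → ℂ} {l : ℂ}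
    (hl : l ≠ 0) (h : Tendsto (fun n : ℕ => (((n : ℝ) + 1) ^ s : ℝ) * x n) atTop (𝓝 l)) :
    x ∉ lpSet p := by
  intro hx
  refine hsp.not_gt (powerSeq_mem_lpSet_iff.1 ?_)
  have hl' : 0 < ‖l‖ / 2 := by positivity
  have hev := h.norm.eventually_const_lt (half_lt_self (norm_pos_iff.2 hl))
  refine Summable.of_norm_bounded_eventually_nat
    ((show Summable fun n => ‖x n‖ ^ p from hx).mul_left (((‖l‖ / 2) ^ p)⁻¹)) ?_
  filter_upwards [hev] with n hn
  have hpos : (0 : ℝ) < ((n : ℝ) + 1) ^ s := by positivity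
  rw [norm_mul, Complex.norm_real, Real.norm_of_nonneg hpos.le] at hn
  rw [Real.norm_of_nonneg (by positivity), ← Real.inv_rpow hl'.le,
    ← Real.mul_rpow (by positivity) (norm_nonneg _), norm_powerSeq]
  refine Real.rpow_le_rpow (by positivity) ?_ hp.le
  rw [Real.rpow_neg (by positivity), inv_mul_eq_div, le_div_iff₀ hl', inv_mul_eq_div,
    div_le_iff₀ hpos]
  linarith

/-- A finite linear combination of finitely supported perturbations of powers `(n + 1) ^ (-s)`,
with distinct exponents `s ≤ 1 / p`, lies in `ℓ^p` only when it is trivial. -/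
lemma eq_zero_of_linearCombination_mem_lpSet {ι : Type*} {p : ℝ} (hp : 0 < p) {s : ι → ℝ}
    (hs : Function.Injective s) (hsp : ∀ i, s i * p ≤ 1) (q : ι → ℕ →₀ ℂ) (c : ι →₀ ℂ)
    (hc : Finsupp.linearCombination ℂ (fun i => ⇑(q i) + powerSeq (s i)) c ∈ lpSet p) :
    c = 0 := by
  classical
  by_contra hne
  obtain ⟨i₀, hi₀, hmin⟩ := c.support.exists_min_image s (Finsupp.support_nonempty_iff.2 hne)
  refine notMem_lpSet_of_tendsto hp (hsp i₀) (Finsupp.mem_support_iff.1 hi₀) ?_ hc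
  have hterm : ∀ i ∈ c.support, Tendsto (fun n : ℕ => c i *
      ((((n : ℝ) + 1) ^ s i₀ : ℝ) * (q i n + powerSeq (s i) n))) atTop
      (𝓝 (if i = i₀ then c i else 0)) := by
    intro i hi
    have hq : ∀ᶠ n in atTop, q i n = 0 := by
      have := (q i).support.finite_toSet.compl_mem_cofinite
      rw [Nat.cofinite_eq_atTop] at this
      filter_upwards [this] with n hn
      simpa using hn
    have hpow : Tendsto (fun n : ℕ => (((n : ℝ) + 1) ^ s i₀ : ℝ) * powerSeq (s i) n) atTop
        (𝓝 (if i = i₀ then 1 else 0)) := by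
      split_ifs with h
      · simp only [h, rpow_mul_powerSeq_self, tendsto_const_nhds]
      · exact tendsto_rpow_mul_powerSeq ((hmin i hi).lt_of_ne fun e => h (hs e).symm)
    have := (hpow.congr' (f₂ := fun n : ℕ => (((n : ℝ) + 1) ^ s i₀ : ℝ) *
      (q i n + powerSeq (s i) n)) (hq.mono fun n hn => by simp only [hn, zero_add])).const_mul (c i)
    simpa only [mul_ite, mul_one, mul_zero] using this
  have hsum := tendsto_finsetSum c.support hterm
  rw [Finset.sum_ite_eq' c.support i₀ c, if_pos hi₀] at hsum
  refine hsum.congr fun n => ?_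
  rw [Finsupp.linearCombination_apply, Finsupp.sum, Finset.sum_apply, Finset.mul_sum]
  refine Finset.sum_congr rfl fun i _ => ?_
  simp only [Pi.smul_apply, Pi.add_apply, smul_eq_mul]
  ring

/-- Truncations of `x ∈ ℓ^p`, perturbed by a small multiple of a power sequence, converge
to `x`. -/
lemma tendsto_tsum_truncation_add {p t : ℝ} (hp : 0 < p) (ht : 1 < t * p) {s : ℕ → ℝ}
    (hs : ∀ N, t ≤ s N) {x : ℕ → ℂ} (hx : x ∈ lpSet p) :
    Tendsto (fun N : ℕ => ∑' n, ‖x n - ((if n ∈ Finset.range N then x n else 0) +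
      ((N : ℂ) + 1)⁻¹ * powerSeq (s N) n)‖ ^ p) atTop (𝓝 0) := by
  have hdom : (fun n => (‖x n‖ + ‖powerSeq t n‖ : ℂ)) ∈ lpSet p := by
    refine (lpSeqSubmodule p hp).add_mem (x := fun n => (‖x n‖ : ℂ))
      (y := fun n => (‖powerSeq t n‖ : ℂ)) ?_ ?_
    · change Summable _
      simpa [lpSet] using hx
    · change Summable _
      simpa [lpSet] using powerSeq_mem_lpSet_iff.2 ht
  have hbound : Summable fun n => (‖x n‖ + ‖powerSeq t n‖) ^ p := by
    refine (show Summable _ from hdom).congr fun n => ?_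
    beta_reduce
    rw [← Complex.ofReal_add, Complex.norm_real, Real.norm_of_nonneg (by positivity)]
  have hpow (N n : ℕ) : ‖powerSeq (s N) n‖ ≤ ‖powerSeq t n‖ := by
    rw [norm_powerSeq, norm_powerSeq]
    exact Real.rpow_le_rpow_of_exponent_le (by simp) (neg_le_neg (hs N))
  have hnorm (N : ℕ) : ‖((N : ℂ) + 1)⁻¹‖ = ((N : ℝ) + 1)⁻¹ := by
    rw [norm_inv, ← Nat.cast_add_one, Complex.norm_natCast, Nat.cast_add_one]
  rw [← tsum_zero (α := ℝ) (β := ℕ)]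
  refine tendsto_tsum_of_dominated_convergence hbound (fun n => ?_)
    (Eventually.of_forall fun N n => ?_)
  · have hsmall : Tendsto (fun N : ℕ => ((N : ℝ) + 1)⁻¹ * ‖powerSeq t n‖) atTop (𝓝 0) := by
      simpa using tendsto_one_div_add_atTop_nhds_zero_nat.mul_const ‖powerSeq t n‖
    have hlim : Tendsto (fun N : ℕ => ‖x n - ((if n ∈ Finset.range N then x n else 0) +
        ((N : ℂ) + 1)⁻¹ * powerSeq (s N) n)‖) atTop (𝓝 0) := by
      refine squeeze_zero' (Eventually.of_forall fun _ => norm_nonneg _) ?_ hsmall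
      filter_upwards [eventually_gt_atTop n] with N hN
      rw [if_pos (Finset.mem_range.2 hN), sub_add_cancel_left, norm_neg, norm_mul, hnorm]
      gcongr
      exact hpow N n
    simpa [Real.zero_rpow hp.ne'] using hlim.rpow_const (p := p) (Or.inr hp.le)
  · rw [Real.norm_of_nonneg (by positivity)]
    refine Real.rpow_le_rpow (norm_nonneg _) ?_ hp.le
    rw [← sub_sub]
    refine (norm_sub_le _ _).trans (add_le_add ?_ ?_)
    · split_ifs <;> simp
    · rw [norm_mul, hnorm]
      exact (mul_le_of_le_one_left (norm_nonneg _)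
        (inv_le_one_of_one_le₀ (by simp))).trans (hpow N n)

lemma exists_injective_Ioo {u v : ℝ} (huv : u < v) :
    ∃ s : ℝ × (ℕ →₀ ℂ) → ℝ, Function.Injective s ∧ ∀ i, s i ∈ Set.Ioo u v := by
  have hcard : Cardinal.mk (ℝ × (ℕ →₀ ℂ)) = Cardinal.mk (Set.Ioo u v) := by
    rw [Cardinal.mk_Ioo_real huv]
    simp [Cardinal.mk_real, Cardinal.aleph0_le_continuum]
  obtain ⟨e⟩ := Cardinal.eq.1 hcard
  exact ⟨fun i => e i, Subtype.val_injective.comp e.injective, fun i => (e i).2⟩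

/-- The spans of the parts of a linearly independent family cut out by the fibres of a map form
a linearly independent family of subspaces. -/
lemma LinearIndependent.eq_zero_of_sum_mem_span_fiber {K V ι κ : Type*} [Field K]
    [AddCommGroup V] [Module K V] {w : ι → V} (hw : LinearIndependent K w) (f : ι → κ)
    (J : Finset κ) (v : κ → V) (hv : ∀ k ∈ J, v k ∈ Submodule.span K (w '' (f ⁻¹' {k})))
    (h0 : ∑ k ∈ J, v k = 0) : ∀ k ∈ J, v k = 0 := by
  classical
  intro k hk
  have hdisj := hw.disjoint_span_image (s := f ⁻¹' {k}) (t := f ⁻¹' {k}ᶜ)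
    (Disjoint.preimage f disjoint_compl_right)
  refine Submodule.disjoint_def.1 hdisj _ (hv k hk) ?_
  rw [← Finset.add_sum_erase J v hk] at h0
  rw [eq_neg_of_add_eq_zero_left h0]
  refine Submodule.neg_mem _ (Submodule.sum_mem _ fun j hj => ?_)
  obtain ⟨hjk, hjJ⟩ := Finset.mem_erase.1 hj
  refine Submodule.span_mono (Set.image_mono (Set.preimage_mono ?_)) (hv j hjJ)
  exact Set.singleton_subset_iff.2 hjk

/-- Let `0 < a < b`. Then there are continuum many linearly independent dense vector
subspaces `F^k` of `ℓ^b` (with its metric topology) such that the vector subspace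
spanned by `⋃_k F^k` is contained in `(ℓ^b \ ℓ^a) ∪ {0}`. -/
theorem statement10 (a b : ℝ) (ha : 0 < a) (hab : a < b) :
    ∃ (I : Type) (F : I → Submodule ℂ (ℕ → ℂ)),
      Cardinal.mk I = Cardinal.continuum ∧
      (∀ k, (F k : Set (ℕ → ℂ)) ⊆ lpSet b) ∧
      (∀ k, @Dense ↥(lpSet b) (lpTopology b)
        (Subtype.val ⁻¹' (F k : Set (ℕ → ℂ)))) ∧
      (∀ (J : Finset I) (v : I → (ℕ → ℂ)), (∀ k ∈ J, v k ∈ F k) →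
        (∑ k ∈ J, v k) = 0 → ∀ k ∈ J, v k = 0) ∧
      (∀ v : ℕ → ℂ, v ∈ (⨆ k, F k : Submodule ℂ (ℕ → ℂ)) → v ≠ 0 →
        v ∈ lpSet b ∧ v ∉ lpSet a) := by
  have hb : 0 < b := ha.trans hab
  obtain ⟨t, hbt, hta⟩ := exists_between (one_div_lt_one_div_of_lt ha hab)
  have htb : 1 < t * b := (div_lt_iff₀ hb).1 hbt
  obtain ⟨s, hs, hst⟩ := exists_injective_Ioo hta
  have hsa (i) : s i * a ≤ 1 := (le_div_iff₀ ha).1 (hst i).2.le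
  set w : ℝ × (ℕ →₀ ℂ) → ℕ → ℂ := fun i => ⇑i.2 + powerSeq (s i) with hw
  have hwb (i) : w i ∈ lpSeqSubmodule b hb :=
    (lpSeqSubmodule b hb).add_mem (finsupp_mem_lpSet hb i.2)
      (powerSeq_mem_lpSet_iff.2 (htb.trans ((mul_lt_mul_iff_left₀ hb).2 (hst i).1)))
  have hzero (c : ℝ × (ℕ →₀ ℂ) →₀ ℂ) (hc : Finsupp.linearCombination ℂ w c ∈ lpSet a) : c = 0 :=
    eq_zero_of_linearCombination_mem_lpSet ha hs hsa Prod.snd c hc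
  have hli : LinearIndependent ℂ w := by
    rw [linearIndependent_iff]
    intro c hc
    refine hzero c ?_
    rw [hc]
    exact (lpSeqSubmodule a ha).zero_mem
  have hspan (S : Set (ℝ × (ℕ →₀ ℂ))) : Submodule.span ℂ (w '' S) ≤ lpSeqSubmodule b hb :=
    Submodule.span_le.2 (Set.image_subset_iff.2 fun i _ => hwb i)
  refine ⟨ℝ, fun k => Submodule.span ℂ (w '' (Prod.fst ⁻¹' {k})), Cardinal.mk_real,
    fun k => hspan _, fun k => dense_lpTopology_of_tendsto hb (hspan _) fun x hx => ?_,
    hli.eq_zero_of_sum_mem_span_fiber Prod.fst, fun v hv hv0 => ?_⟩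
  · let i (N : ℕ) : ℝ × (ℕ →₀ ℂ) := (k, Finsupp.onFinset (Finset.range N)
      (fun n => if n ∈ Finset.range N then ((N : ℂ) + 1) * x n else 0) (by simp +contextual))
    refine ⟨fun N => ((N : ℂ) + 1)⁻¹ • w (i N), fun N => Submodule.smul_mem _ _
      (Submodule.subset_span ⟨i N, rfl, rfl⟩), ?_⟩
    refine (tendsto_tsum_truncation_add hb htb (fun N => (hst (i N)).1.le) hx).congr fun N => ?_
    have hN : (N : ℂ) + 1 ≠ 0 := Nat.cast_add_one_ne_zero N
    refine tsum_congr fun n => ?_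
    simp only [hw, i, Pi.smul_apply, Pi.add_apply, Finsupp.onFinset_apply, smul_eq_mul, mul_add,
      mul_ite, mul_zero, inv_mul_cancel_left₀ hN]
  · have hv' : v ∈ Submodule.span ℂ (Set.range w) :=
      iSup_le (fun k => Submodule.span_mono (Set.image_subset_range _ _)) hv
    refine ⟨Submodule.span_le.2 (Set.range_subset_iff.2 hwb) hv', fun hva => hv0 ?_⟩
    obtain ⟨c, rfl⟩ := Finsupp.mem_span_range_iff_exists_finsupp.1 hv'
    rw [hzero c hva, Finsupp.sum_zero_index]

end
end

section
/- Let a ∈ (0,∞). Then there exist a set I with card(I) = 𝔠 and a linearly independent family (F^k)_{k∈I} of dense vector subspaces of c₀ such that the vector subspace of c₀ spanned by ⋃_{k∈I} F^k is contained in (c₀ \ ℓ^a) ∪ {0}. In particular, c₀ \ ℓ^a is maximal algebraically generic in c₀. -/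
open Filter Topology

noncomputable section

/-- The sup metric `d^∞(x,y) = sup_n |x n - y n|`. -/
def dsup (x y : ℕ → ℂ) : ℝ := ⨆ n, ‖x n - y n‖

/-- The space `ℓ^∞` of bounded complex sequences. -/
def linfSet : Set (ℕ → ℂ) := {x | ∃ C : ℝ, ∀ n, ‖x n‖ ≤ C}

/-- The space `c₀` of complex sequences tending to `0`. -/
def c0Set : Set (ℕ → ℂ) := {x | Tendsto x atTop (𝓝 0)}

theorem tendsto_natCast_add_one_rpow_neg {t : ℝ} (ht : 0 < t) :
    Tendsto (fun n : ℕ => ((n : ℝ) + 1) ^ (-t)) atTop (𝓝 0) :=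
  (tendsto_rpow_neg_atTop ht).comp
    (tendsto_atTop_add_const_right _ _ tendsto_natCast_atTop_atTop)

/-- A sequence that decays exactly like `n ^ (-t)` with `t * a < 1` is not in `ℓ^a`. -/
theorem notMem_lpSet_of_tendsto_s14 {a t : ℝ} (ha : 0 < a) (hta : t * a < 1) {v : ℕ → ℂ} {L : ℂ}
    (hL : L ≠ 0)
    (hv : Tendsto (fun n : ℕ => ((((n : ℝ) + 1) ^ t : ℝ) : ℂ) * v n) atTop (𝓝 L)) :
    v ∉ lpSet a := by
  intro hs
  have hs : Summable fun n => ‖v n‖ ^ a := hs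
  have hc : 0 < ‖L‖ / 2 := by positivity
  have hev : ∀ᶠ n : ℕ in atTop, ‖L‖ / 2 < ‖((((n : ℝ) + 1) ^ t : ℝ) : ℂ) * v n‖ :=
    hv.norm.eventually_const_lt (half_lt_self (norm_pos_iff.mpr hL))
  have hsum : Summable fun n : ℕ => ((n : ℝ) + 1)⁻¹ := by
    refine Summable.of_norm_bounded_eventually_nat (hs.mul_left (((‖L‖ / 2) ^ a)⁻¹)) ?_
    filter_upwards [hev] with n hn
    have hn0 : (1 : ℝ) ≤ (n : ℝ) + 1 := by linarith [n.cast_nonneg (α := ℝ)]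
    have hn1 : (0 : ℝ) < (n : ℝ) + 1 := by linarith
    rw [norm_mul, Complex.norm_real, Real.norm_of_nonneg (by positivity)] at hn
    have h1 := Real.rpow_le_rpow hc.le hn.le ha.le
    rw [Real.mul_rpow (by positivity) (norm_nonneg _), ← Real.rpow_mul hn1.le] at h1
    have h2 : ((n : ℝ) + 1) ^ (t * a) ≤ (n : ℝ) + 1 := by
      simpa using Real.rpow_le_rpow_of_exponent_le hn0 hta.le
    have h3 : (‖L‖ / 2) ^ a ≤ ((n : ℝ) + 1) * ‖v n‖ ^ a :=
      h1.trans (mul_le_mul_of_nonneg_right h2 (by positivity))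
    rw [Real.norm_of_nonneg (by positivity), inv_mul_eq_div, le_div_iff₀ (by positivity),
      inv_mul_le_iff₀ hn1]
    exact h3
  refine Real.not_summable_natCast_inv ((summable_nat_add_iff 1).mp ?_)
  simpa using hsum

/-- The truncation of `x` to its first `N` terms plus a power sequence of sup norm at most
`1 / (N + 1)`. -/
def truncAddPow (x : ℕ → ℂ) (N : ℕ) (t : ℝ) (n : ℕ) : ℂ :=
  (if n < N then x n else 0) + ((((n : ℝ) + 1) ^ (-t) / ((N : ℝ) + 1) : ℝ) : ℂ)

theorem truncAddPow_mem_c0Set (x : ℕ → ℂ) (N : ℕ) {t : ℝ} (ht : 0 < t) :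
    truncAddPow x N t ∈ c0Set := by
  have h := (tendsto_natCast_add_one_rpow_neg ht).div_const ((N : ℝ) + 1)
  rw [zero_div] at h
  have h' := (Complex.continuous_ofReal.tendsto 0).comp h
  rw [Complex.ofReal_zero] at h'
  refine h'.congr' ?_
  filter_upwards [eventually_ge_atTop N] with n hn
  simp [truncAddPow, not_lt.mpr hn]

theorem tendsto_rpow_mul_truncAddPow (x : ℕ → ℂ) (N : ℕ) {t₀ t : ℝ} (h : t₀ ≤ t) :
    Tendsto (fun n : ℕ => ((((n : ℝ) + 1) ^ t₀ : ℝ) : ℂ) * truncAddPow x N t n) atTop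
      (𝓝 (if t = t₀ then (((N : ℝ) + 1 : ℝ) : ℂ)⁻¹ else 0)) := by
  have key : (fun n : ℕ => (((((n : ℝ) + 1) ^ (-(t - t₀)) / ((N : ℝ) + 1) : ℝ)) : ℂ))
      =ᶠ[atTop] fun n : ℕ => ((((n : ℝ) + 1) ^ t₀ : ℝ) : ℂ) * truncAddPow x N t n := by
    filter_upwards [eventually_ge_atTop N] with n hn
    have hn1 : (0 : ℝ) < (n : ℝ) + 1 := by positivity
    rw [truncAddPow, if_neg (not_lt.mpr hn), zero_add, ← Complex.ofReal_mul, ← mul_div_assoc,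
      ← Real.rpow_add hn1]
    congr 3
    ring
  refine Tendsto.congr' key ?_
  split_ifs with ht
  · subst ht
    simp
  · have h0 := (tendsto_natCast_add_one_rpow_neg
      (sub_pos.mpr (lt_of_le_of_ne h (Ne.symm ht)))).div_const ((N : ℝ) + 1)
    rw [zero_div] at h0
    have h1 := (Complex.continuous_ofReal.tendsto 0).comp h0
    rw [Complex.ofReal_zero] at h1
    exact h1

section Family

variable {ι : Type*} {a : ℝ} {x : ι → ℕ → ℂ} {N : ι → ℕ} {t : ι → ℝ}

theorem linearCombination_truncAddPow_notMem_lpSet (ha : 0 < a) (hinj : Function.Injective t)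
    (hta : ∀ i, t i * a < 1) {l : ι →₀ ℂ} (hl : l ≠ 0) :
    Finsupp.linearCombination ℂ (fun i => truncAddPow (x i) (N i) (t i)) l ∉ lpSet a := by
  classical
  obtain ⟨i₀, hi₀, hmin⟩ :=
    l.support.exists_min_image t (Finsupp.support_nonempty_iff.mpr hl)
  have hN : (((N i₀ : ℝ) + 1 : ℝ) : ℂ) ≠ 0 := by
    exact_mod_cast (by positivity : ((N i₀ : ℝ) + 1) ≠ 0)
  refine notMem_lpSet_of_tendsto_s14 ha (hta i₀)
    (mul_ne_zero (Finsupp.mem_support_iff.mp hi₀) (inv_ne_zero hN)) ?_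
  have hsum := tendsto_finsetSum l.support fun i hi =>
    (tendsto_rpow_mul_truncAddPow (x i) (N i) (hmin i hi)).const_mul (l i)
  convert hsum using 2
  · simp only [Finsupp.linearCombination_apply, Finsupp.sum, Finset.sum_apply, Pi.smul_apply,
      smul_eq_mul, Finset.mul_sum]
    exact Finset.sum_congr rfl fun i _ => by ring
  · rw [Finset.sum_eq_single_of_mem i₀ hi₀, if_pos rfl]
    intro i _ hne
    rw [if_neg (hinj.ne hne), mul_zero]

theorem zero_mem_lpSet (ha : 0 < a) : (0 : ℕ → ℂ) ∈ lpSet a := by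
  simp [lpSet, Real.zero_rpow ha.ne', summable_zero]

theorem linearIndependent_truncAddPow (ha : 0 < a) (hinj : Function.Injective t)
    (hta : ∀ i, t i * a < 1) :
    LinearIndependent ℂ fun i => truncAddPow (x i) (N i) (t i) := by
  rw [linearIndependent_iff]
  intro l hl
  by_contra hne
  exact linearCombination_truncAddPow_notMem_lpSet ha hinj hta hne
    (hl ▸ zero_mem_lpSet ha)

theorem notMem_lpSet_of_mem_span (ha : 0 < a) (hinj : Function.Injective t)
    (hta : ∀ i, t i * a < 1) {v : ℕ → ℂ}
    (hv : v ∈ Submodule.span ℂ (Set.range fun i => truncAddPow (x i) (N i) (t i)))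
    (hv0 : v ≠ 0) : v ∉ lpSet a := by
  obtain ⟨l, rfl⟩ := Finsupp.mem_span_range_iff_exists_finsupp.mp hv
  refine linearCombination_truncAddPow_notMem_lpSet ha hinj hta fun hl => hv0 ?_
  simp [hl]

theorem mem_c0Set_of_mem_span (ht : ∀ i, 0 < t i) {v : ℕ → ℂ}
    (hv : v ∈ Submodule.span ℂ (Set.range fun i => truncAddPow (x i) (N i) (t i))) :
    v ∈ c0Set := by
  induction hv using Submodule.span_induction with
  | mem v hv =>
    obtain ⟨i, rfl⟩ := hv
    exact truncAddPow_mem_c0Set _ _ (ht i)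
  | zero => exact tendsto_const_nhds
  | add v w _ _ hv hw =>
    have h := Tendsto.add (show Tendsto v _ _ from hv) hw
    rwa [add_zero] at h
  | smul c v _ hv =>
    have h := Tendsto.const_mul c (show Tendsto v _ _ from hv)
    rwa [mul_zero] at h

end Family

theorem bddAbove_norm_sub_of_mem_c0Set {x y : ℕ → ℂ} (hx : x ∈ c0Set) (hy : y ∈ c0Set) :
    BddAbove (Set.range fun n => ‖x n - y n‖) :=
  (Tendsto.sub (show Tendsto x _ _ from hx) hy).norm.bddAbove_range

theorem dsup_triangle {x y z : ℕ → ℂ} (hx : x ∈ c0Set) (hy : y ∈ c0Set) (hz : z ∈ c0Set) :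
    dsup x z ≤ dsup x y + dsup y z :=
  ciSup_le fun n => (norm_sub_le_norm_sub_add_norm_sub _ (y n) _).trans
    (add_le_add (le_ciSup (bddAbove_norm_sub_of_mem_c0Set hx hy) n)
      (le_ciSup (bddAbove_norm_sub_of_mem_c0Set hy hz) n))

theorem dense_topOfDist {α : Type*} {d : α → α → ℝ}
    (htri : ∀ x y z, d x z ≤ d x y + d y z) {S : Set α}
    (hS : ∀ x, ∀ r > 0, ∃ y ∈ S, d x y < r) : @Dense α (topOfDist d) S := by
  let := topOfDist d
  have hball : ∀ O : Set α, IsOpen O → ∀ x ∈ O, ∃ r > 0, ∀ y, d x y < r → y ∈ O := by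
    intro O hO
    have hO : TopologicalSpace.GenerateOpen {S | ∃ x r, S = {y | d x y < r}} O := hO
    induction hO with
    | basic s hs =>
      obtain ⟨z, r, rfl⟩ := hs
      intro x hx
      refine ⟨r - d z x, sub_pos.mpr hx, fun y hy => ?_⟩
      have := htri z x y
      change d z y < r
      linarith
    | univ => exact fun x _ => ⟨1, one_pos, fun _ _ => trivial⟩
    | inter s u hs hu ihs ihu =>
      intro x hx
      obtain ⟨r₁, h₁, H₁⟩ := ihs hs x hx.1
      obtain ⟨r₂, h₂, H₂⟩ := ihu hu x hx.2
      exact ⟨min r₁ r₂, lt_min h₁ h₂, fun y hy =>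
        ⟨H₁ y (hy.trans_le (min_le_left _ _)), H₂ y (hy.trans_le (min_le_right _ _))⟩⟩
    | sUnion T hT ih =>
      rintro x ⟨s, hs, hx⟩
      obtain ⟨r, hr, H⟩ := ih s hs (hT s hs) x hx
      exact ⟨r, hr, fun y hy => ⟨s, hs, H y hy⟩⟩
  rw [dense_iff_inter_open]
  rintro O hO ⟨x, hx⟩
  obtain ⟨r, hr, H⟩ := hball O hO x hx
  obtain ⟨y, hy, hxy⟩ := hS x r hr
  exact ⟨y, H y hxy, hy⟩

theorem exists_dsup_truncAddPow_lt {x : ℕ → ℂ} (hx : x ∈ c0Set) {r : ℝ} (hr : 0 < r) :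
    ∃ N : ℕ, ∀ t : ℝ, 0 < t → dsup x (truncAddPow x N t) < r := by
  have h1 : ∀ᶠ N : ℕ in atTop, ∀ n ≥ N, ‖x n‖ < r / 3 := by
    rw [eventually_forall_ge_atTop]
    have hn := (show Tendsto x _ _ from hx).norm
    rw [norm_zero] at hn
    exact hn.eventually_lt_const (by positivity)
  have h2 : ∀ᶠ N : ℕ in atTop, 1 / ((N : ℝ) + 1) < r / 3 :=
    tendsto_one_div_add_atTop_nhds_zero_nat.eventually_lt_const (by positivity)
  obtain ⟨N, hN1, hN2⟩ := (h1.and h2).exists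
  refine ⟨N, fun t ht => ?_⟩
  suffices h : dsup x (truncAddPow x N t) ≤ r / 3 + r / 3 by linarith
  refine ciSup_le fun n => ?_
  have hpow : ‖((((n : ℝ) + 1) ^ (-t) / ((N : ℝ) + 1) : ℝ) : ℂ)‖ ≤ r / 3 := by
    rw [Complex.norm_real, Real.norm_of_nonneg (by positivity)]
    refine le_trans ?_ hN2.le
    gcongr
    exact Real.rpow_le_one_of_one_le_of_nonpos
      (by linarith [n.cast_nonneg (α := ℝ)]) (by linarith)
  rw [truncAddPow, ← sub_sub]
  refine (norm_sub_le _ _).trans (add_le_add ?_ hpow)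
  split_ifs with hn
  · simpa using by positivity
  · simpa using (hN1 n (not_lt.mp hn)).le

/-- A subspace of `c₀` is dense as soon as it contains, for every `x` and `N`, some
`truncAddPow x N t`. -/
theorem dense_preimage_of_truncAddPow_mem {F : Submodule ℂ (ℕ → ℂ)}
    (hF : ∀ x N, ∃ t : ℝ, 0 < t ∧ truncAddPow x N t ∈ F) :
    @Dense ↥c0Set (topOfDist fun x y => dsup x.1 y.1)
      (Subtype.val ⁻¹' (F : Set (ℕ → ℂ))) := by
  have htri : ∀ x y z : ↥c0Set, dsup x.1 z.1 ≤ dsup x.1 y.1 + dsup y.1 z.1 :=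
    fun x y z => dsup_triangle x.2 y.2 z.2
  refine dense_topOfDist (d := fun x y : ↥c0Set => dsup x.1 y.1) htri fun x r hr => ?_
  obtain ⟨N, hN⟩ := exists_dsup_truncAddPow_lt x.2 hr
  obtain ⟨t, ht, hmem⟩ := hF x.1 N
  exact ⟨⟨_, truncAddPow_mem_c0Set x.1 N ht⟩, hmem, hN t ht⟩

theorem mk_nat_to_complex : Cardinal.mk (ℕ → ℂ) = Cardinal.continuum := by
  simp

theorem LinearIndependent.iSupIndep_span_range_prod {R M I K : Type*} [Ring R] [Nontrivial R]
    [AddCommGroup M] [Module R M] {e : I × K → M} (he : LinearIndependent R e) :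
    iSupIndep fun i => Submodule.span R (Set.range fun k => e (i, k)) := by
  intro i
  have hdisj : Disjoint {p : I × K | p.1 = i} {p : I × K | p.1 ≠ i} :=
    Set.disjoint_left.mpr fun _ h h' => h' h
  refine (he.disjoint_span_image hdisj).mono (Submodule.span_mono ?_)
    (iSup₂_le fun j hj => Submodule.span_mono ?_)
  · rintro _ ⟨k, rfl⟩
    exact ⟨(i, k), rfl, rfl⟩
  · rintro _ ⟨k, rfl⟩
    exact ⟨(j, k), hj, rfl⟩

/-- Let `a ∈ (0,∞)`. Then there are continuum many linearly independent dense vector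
subspaces `F^k` of `c₀` (with the sup metric) such that the vector subspace
spanned by `⋃_k F^k` is contained in `(c₀ \ ℓ^a) ∪ {0}`. In particular,
`c₀ \ ℓ^a` is maximal algebraically generic in `c₀`. -/
theorem statement14 (a : ℝ) (ha : 0 < a) :
    (∃ (I : Type) (F : I → Submodule ℂ (ℕ → ℂ)),
      Cardinal.mk I = Cardinal.continuum ∧
      (∀ k, (F k : Set (ℕ → ℂ)) ⊆ c0Set) ∧
      (∀ k, @Dense ↥c0Set (topOfDist fun x y => dsup x.1 y.1)
        (Subtype.val ⁻¹' (F k : Set (ℕ → ℂ)))) ∧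
      (∀ (J : Finset I) (v : I → (ℕ → ℂ)), (∀ k ∈ J, v k ∈ F k) →
        (∑ k ∈ J, v k) = 0 → ∀ k ∈ J, v k = 0) ∧
      (∀ v : ℕ → ℂ, v ∈ (⨆ k, F k : Submodule ℂ (ℕ → ℂ)) → v ≠ 0 →
        v ∈ c0Set ∧ v ∉ lpSet a)) ∧
    (∃ F : Submodule ℂ (ℕ → ℂ),
      (F : Set (ℕ → ℂ)) ⊆ c0Set ∧
      @Dense ↥c0Set (topOfDist fun x y => dsup x.1 y.1)
        (Subtype.val ⁻¹' (F : Set (ℕ → ℂ))) ∧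
      (∀ v ∈ F, v ≠ 0 → v ∉ lpSet a) ∧
      Module.rank ℂ F = Module.rank ℂ (Submodule.span ℂ c0Set)) := by
  have hcard : Cardinal.mk (ℝ × ((ℕ → ℂ) × ℕ)) = Cardinal.continuum := by
    simp [Cardinal.mk_real]
  have hIoo : Cardinal.mk (Set.Ioo 0 (1 / a)) = Cardinal.continuum :=
    Cardinal.mk_Ioo_real (by positivity)
  obtain ⟨τ⟩ := Cardinal.eq.mp (hcard.trans hIoo.symm)
  let t : ℝ × ((ℕ → ℂ) × ℕ) → ℝ := fun p => τ p
  have hinj : Function.Injective t := Subtype.val_injective.comp τ.injective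
  have ht : ∀ p, 0 < t p := fun p => (τ p).2.1
  have hta : ∀ p, t p * a < 1 := fun p => (lt_div_iff₀ ha).mp (τ p).2.2
  let e : ℝ × ((ℕ → ℂ) × ℕ) → ℕ → ℂ := fun p => truncAddPow p.2.1 p.2.2 (t p)
  have hli : LinearIndependent ℂ e := linearIndependent_truncAddPow ha hinj hta
  let F : ℝ → Submodule ℂ (ℕ → ℂ) := fun s => Submodule.span ℂ (Set.range fun k => e (s, k))
  have hF : ∀ s, F s ≤ Submodule.span ℂ (Set.range e) := fun s =>
    Submodule.span_mono (Set.range_comp_subset_range (fun k => (s, k)) e)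
  have hc0 : ∀ v ∈ Submodule.span ℂ (Set.range e), v ∈ c0Set := fun v hv =>
    mem_c0Set_of_mem_span ht hv
  have hlp : ∀ v ∈ Submodule.span ℂ (Set.range e), v ≠ 0 → v ∉ lpSet a := fun v hv =>
    notMem_lpSet_of_mem_span ha hinj hta hv
  refine ⟨⟨ℝ, F, Cardinal.mk_real, fun s v hv => hc0 v (hF s hv), fun s => ?_, ?_, ?_⟩,
    Submodule.span ℂ (Set.range e), hc0, ?_, hlp, ?_⟩
  · exact dense_preimage_of_truncAddPow_mem fun x N =>
      ⟨_, ht (s, (x, N)), Submodule.subset_span ⟨(x, N), rfl⟩⟩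
  · exact fun J v hv hsum =>
      (iSupIndep_iff_finsetSum_eq_zero_imp_eq_zero F).mp hli.iSupIndep_span_range_prod J v hv hsum
  · exact fun v hv hv0 => ⟨hc0 v (iSup_le hF hv), hlp v (iSup_le hF hv) hv0⟩
  · exact dense_preimage_of_truncAddPow_mem fun x N =>
      ⟨_, ht (0, (x, N)), Submodule.subset_span ⟨(0, (x, N)), rfl⟩⟩
  · refine le_antisymm (Submodule.rank_mono fun v hv => Submodule.subset_span (hc0 v hv)) ?_
    rw [rank_span hli, Cardinal.mk_range_eq e hli.injective, hcard, ← mk_nat_to_complex]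
    exact (Submodule.rank_le _).trans (rank_le_card ℂ _)

end
end
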